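/- Lower bound for the shifted fiber operator (Proposition 4.3): Let ω ∈ (0, π/2) and k ∈ ℤ. Then for every ψ ∈ M one has ‖(T_k − 1/2)ψ‖_{L²((0,ω);ℂ⁴)} ≥ (π/(4ω)) · ‖ψ‖_{L²((0,ω);ℂ⁴)}. -/

import Mathlib

open MeasureTheory Real Set

noncomputable section

/-- First component of the fiber differential expression `τ_k` applied to a pair `(f,g)`:
`(k+1) f − g' − (k+1/2) cot θ · g`. -/
def tauFst (k : ℤ) (f g : ℝ → ℂ) (θ : ℝ) : ℂ :=
  ((k : ℂ) + 1) * f θ - deriv g θ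
    - ((k : ℂ) + 1 / 2) * ((Real.cos θ / Real.sin θ : ℝ) : ℂ) * g θ

/-- Second component of the fiber differential expression `τ_k` applied to a pair `(f,g)`:
`f' − (k+1/2) cot θ · f − k g`. -/
def tauSnd (k : ℤ) (f g : ℝ → ℂ) (θ : ℝ) : ℂ :=
  deriv f θ - ((k : ℂ) + 1 / 2) * ((Real.cos θ / Real.sin θ : ℝ) : ℂ) * f θ
    - (k : ℂ) * g θ

/-- The core `M` of the fiber operator `T_k`: smooth `ℂ⁴`-valued functions
`ψ = (ψ₁,ψ₂,ψ₃,ψ₄)` on `(0,ω]` with compact support in `(0,ω]` satisfying the boundary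
condition `(ψ₁(ω), ψ₂(ω))ᵀ = A_ω (ψ₃(ω), ψ₄(ω))ᵀ` with
`A_ω = [[i sin ω, −i cos ω], [−i cos ω, −i sin ω]]`. -/
def InCore (ω : ℝ) (ψ₁ ψ₂ ψ₃ ψ₄ : ℝ → ℂ) : Prop :=
  ContDiffOn ℝ (⊤ : ℕ∞) ψ₁ (Ioc 0 ω) ∧ ContDiffOn ℝ (⊤ : ℕ∞) ψ₂ (Ioc 0 ω)
    ∧ ContDiffOn ℝ (⊤ : ℕ∞) ψ₃ (Ioc 0 ω) ∧ ContDiffOn ℝ (⊤ : ℕ∞) ψ₄ (Ioc 0 ω)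
    ∧ IsCompact (tsupport ψ₁) ∧ tsupport ψ₁ ⊆ Ioc 0 ω
    ∧ IsCompact (tsupport ψ₂) ∧ tsupport ψ₂ ⊆ Ioc 0 ω
    ∧ IsCompact (tsupport ψ₃) ∧ tsupport ψ₃ ⊆ Ioc 0 ω
    ∧ IsCompact (tsupport ψ₄) ∧ tsupport ψ₄ ⊆ Ioc 0 ω
    ∧ ψ₁ ω = Complex.I * (Real.sin ω : ℂ) * ψ₃ ω - Complex.I * (Real.cos ω : ℂ) * ψ₄ ω
    ∧ ψ₂ ω = -Complex.I * (Real.cos ω : ℂ) * ψ₃ ω - Complex.I * (Real.sin ω : ℂ) * ψ₄ ω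

/-- The boundary form for a real pair. -/
def bForm (m q c x y : ℝ) : ℝ := q * (x ^ 2 + y ^ 2) - m * (c * (x ^ 2 - y ^ 2) + 2 * x * y)

/-- Its derivative. -/
def bFormD (m q c q' c' x y x' y' : ℝ) : ℝ :=
  q' * (x ^ 2 + y ^ 2) + q * (2 * x * x' + 2 * y * y')
    - m * (c' * (x ^ 2 - y ^ 2) + c * (2 * x * x' - 2 * y * y') + 2 * (x' * y + x * y'))

lemma bForm_hasDerivAt (m : ℝ) {q c x y : ℝ → ℝ} {q' c' x' y' t : ℝ}
    (hq : HasDerivAt q q' t) (hc : HasDerivAt c c' t) (hx : HasDerivAt x x' t)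
    (hy : HasDerivAt y y' t) :
    HasDerivAt (fun s => bForm m (q s) (c s) (x s) (y s))
      (bFormD m (q t) (c t) q' c' (x t) (y t) x' y') t := by
  unfold bForm bFormD
  have h := (hq.mul ((hx.pow 2).add (hy.pow 2))).sub
    (((hc.mul ((hx.pow 2).sub (hy.pow 2))).add ((hx.mul hy).const_mul 2)).const_mul m)
  refine (h.congr_deriv ?_).congr_of_eventuallyEq (Filter.Eventually.of_forall fun s => ?_)
  · simp only [Pi.add_apply, Pi.sub_apply, Pi.pow_apply]; push_cast; ring
  · simp only [Pi.add_apply, Pi.sub_apply, Pi.pow_apply, Pi.mul_apply]; ring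

lemma bForm_cont (m : ℝ) {q c x y : ℝ → ℝ} {S : Set ℝ}
    (hq : ContinuousOn q S) (hc : ContinuousOn c S) (hx : ContinuousOn x S)
    (hy : ContinuousOn y S) :
    ContinuousOn (fun s => bForm m (q s) (c s) (x s) (y s)) S := by
  unfold bForm
  fun_prop

lemma pair_ineq (m q c q' lam x y x' y' : ℝ)
    (h : (1 + c ^ 2) / 4 + lam ≤ - q' - q ^ 2) :
    bFormD m q c q' (-(1 + c ^ 2)) x y x' y' ≤
      (m * x - y' - m * c * y) ^ 2 + (x' - m * c * x - m * y) ^ 2 - lam * (x ^ 2 + y ^ 2) := by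
  have e : (m * x - y' - m * c * y) ^ 2 + (x' - m * c * x - m * y) ^ 2 - lam * (x ^ 2 + y ^ 2)
      - bFormD m q c q' (-(1 + c ^ 2)) x y x' y'
      = (x' - q * x) ^ 2 + (y' - q * y) ^ 2
        + ((- q' - q ^ 2) - ((1 + c ^ 2) / 4 + lam)) * (x ^ 2 + y ^ 2)
        + (m - 1 / 2) ^ 2 * (1 + c ^ 2) * x ^ 2 + (m + 1 / 2) ^ 2 * (1 + c ^ 2) * y ^ 2 := by
    unfold bFormD; ring
  have h0 : 0 ≤ (- q' - q ^ 2) - ((1 + c ^ 2) / 4 + lam) := by linarith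
  have : 0 ≤ (x' - q * x) ^ 2 + (y' - q * y) ^ 2
        + ((- q' - q ^ 2) - ((1 + c ^ 2) / 4 + lam)) * (x ^ 2 + y ^ 2)
        + (m - 1 / 2) ^ 2 * (1 + c ^ 2) * x ^ 2 + (m + 1 / 2) ^ 2 * (1 + c ^ 2) * y ^ 2 := by
    positivity
  linarith

lemma complex_pair (k : ℤ) (f g : ℝ → ℂ) (t q q' lam : ℝ)
    (h : (1 + (cos t / sin t) ^ 2) / 4 + lam ≤ - q' - q ^ 2) :
    bFormD (k + 1 / 2) q (cos t / sin t) q' (-(1 + (cos t / sin t) ^ 2))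
        (f t).re (g t).re (deriv f t).re (deriv g t).re
      + bFormD (k + 1 / 2) q (cos t / sin t) q' (-(1 + (cos t / sin t) ^ 2))
        (f t).im (g t).im (deriv f t).im (deriv g t).im ≤
      ‖tauFst k f g t - (1 / 2) * f t‖ ^ 2 + ‖tauSnd k f g t - (1 / 2) * g t‖ ^ 2
        - lam * (‖f t‖ ^ 2 + ‖g t‖ ^ 2) := by
  have h1 := pair_ineq (k + 1 / 2) q (cos t / sin t) q' lam
    (f t).re (g t).re (deriv f t).re (deriv g t).re h
  have h2 := pair_ineq (k + 1 / 2) q (cos t / sin t) q' lam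
    (f t).im (g t).im (deriv f t).im (deriv g t).im h
  have e1 : tauFst k f g t - (1 / 2) * f t = (((k : ℝ) + 1 / 2 : ℝ) : ℂ) * f t - deriv g t
      - (((k + 1 / 2) * (cos t / sin t) : ℝ) : ℂ) * g t := by
    unfold tauFst; push_cast; ring
  have e2 : tauSnd k f g t - (1 / 2) * g t = deriv f t
      - (((k + 1 / 2) * (cos t / sin t) : ℝ) : ℂ) * f t - (((k : ℝ) + 1 / 2 : ℝ) : ℂ) * g t := by
    unfold tauSnd; push_cast; ring
  rw [e1, e2]
  simp only [Complex.sq_norm, Complex.normSq_apply, Complex.sub_re, Complex.sub_im,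
    Complex.re_ofReal_mul, Complex.im_ofReal_mul]
  linarith

lemma sin_mul_le {c t : ℝ} (hc : 1 ≤ c) (ht : 0 ≤ t) (h : c * t ≤ π / 2) :
    sin (c * t) ≤ c * sin t := by
  have hconc := strictConcaveOn_sin_Icc.concaveOn
  have hc0 : 0 < c := by linarith
  have m0 : (0 : ℝ) ∈ Icc 0 π := ⟨le_rfl, pi_pos.le⟩
  have m1 : c * t ∈ Icc 0 π := ⟨by positivity, by linarith [pi_pos]⟩
  have w0 : 0 ≤ 1 - 1 / c := by rw [sub_nonneg, div_le_one hc0]; exact hc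
  have w1 : 0 ≤ 1 / c := by positivity
  have := And.right hconc m0 m1 w0 w1 (by ring)
  simp only [smul_eq_mul, mul_zero, sin_zero, zero_add] at this
  rw [show 1 / c * (c * t) = t by field_simp] at this
  rw [one_div, inv_mul_le_iff₀ hc0] at this
  exact this

lemma cot_hasDerivAt {t : ℝ} (h : sin t ≠ 0) :
    HasDerivAt (fun s => cos s / sin s) (-(1 + (cos t / sin t) ^ 2)) t := by
  refine ((hasDerivAt_cos t).div (hasDerivAt_sin t) h).congr_deriv ?_
  field_simp
  ring

lemma weight_ineq {c t : ℝ} (hc : 1 ≤ c) (ht : 0 < t) (h : c * t ≤ π / 2) :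
    (1 + (cos t / sin t) ^ 2) / 4 + c ^ 2 / 4 ≤
      - (c / 2 * (-(1 + (cos (c * t) / sin (c * t)) ^ 2) * c))
        - (c / 2 * (cos (c * t) / sin (c * t))) ^ 2 := by
  have hct : t ≤ c * t := by nlinarith
  have s1 : 0 < sin t := sin_pos_of_pos_of_lt_pi ht (by linarith [pi_pos])
  have s2 : 0 < sin (c * t) := sin_pos_of_pos_of_lt_pi (by linarith) (by linarith [pi_pos])
  have hle := sin_mul_le hc ht.le h
  have e1 : 1 + (cos t / sin t) ^ 2 = (1 / sin t) ^ 2 := by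
    field_simp; linarith [sin_sq_add_cos_sq t]
  have e2 : 1 + (cos (c * t) / sin (c * t)) ^ 2 = (1 / sin (c * t)) ^ 2 := by
    field_simp; linarith [sin_sq_add_cos_sq (c * t)]
  have h3 : 1 / sin t ≤ c * (1 / sin (c * t)) := by
    rw [mul_one_div, div_le_div_iff₀ s1 s2]; linarith
  have h4 : (1 / sin t) ^ 2 ≤ (c * (1 / sin (c * t))) ^ 2 :=
    pow_le_pow_left₀ (by positivity) h3 2
  have e3 : (cos (c * t) / sin (c * t)) ^ 2 = (1 / sin (c * t)) ^ 2 - 1 := by linarith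
  rw [mul_pow, e3, e1]
  nlinarith

lemma exists_delta {w : ℝ} {f : ℝ → ℂ} (hK : IsCompact (tsupport f))
    (hs : tsupport f ⊆ Ioc 0 w) : ∃ d > 0, ∀ x < d, f x = 0 := by
  rcases (tsupport f).eq_empty_or_nonempty with he | hne
  · refine ⟨1, one_pos, fun x _ => image_eq_zero_of_notMem_tsupport (by simp [he])⟩
  · obtain ⟨d, hd, hm⟩ := hK.exists_isLeast hne
    refine ⟨d, (hs hd).1, fun x hx => image_eq_zero_of_notMem_tsupport fun hx' => ?_⟩
    exact absurd (hm hx') (not_le.mpr hx)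

lemma hasDerivAt_of_core {w t : ℝ} {f : ℝ → ℂ} (hf : ContDiffOn ℝ (⊤ : ℕ∞) f (Ioc 0 w))
    (ht : t ∈ Ioo 0 w) : HasDerivAt f (deriv f t) t := by
  have : ContDiffAt ℝ (⊤ : ℕ∞) f t := hf.contDiffAt (Ioc_mem_nhds ht.1 ht.2)
  exact (this.differentiableAt (by simp)).hasDerivAt

lemma deriv_eq_zero_of_left {d t : ℝ} {f : ℝ → ℂ} (hf : ∀ x < d, f x = 0) (ht : t < d) :
    deriv f t = 0 := by
  have : f =ᶠ[nhds t] fun _ => 0 := by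
    filter_upwards [Iio_mem_nhds ht] with x hx using hf x hx
  rw [this.deriv_eq]; simp

lemma derivWithin_cont {w : ℝ} (hw : 0 < w) {f : ℝ → ℂ}
    (hf : ContDiffOn ℝ (⊤ : ℕ∞) f (Ioc 0 w)) :
    ContinuousOn (derivWithin f (Ioc 0 w)) (Ioc 0 w) :=
  hf.continuousOn_derivWithin (uniqueDiffOn_Ioc 0 w) (by simp)

lemma derivWithin_eq {w t : ℝ} {f : ℝ → ℂ} (ht : t ∈ Ioo 0 w) :
    derivWithin f (Ioc 0 w) t = deriv f t :=
  derivWithin_of_mem_nhds (Ioc_mem_nhds ht.1 ht.2)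

lemma sin_ne_of_mem {w t : ℝ} (hw : w < π / 2) (ht : t ∈ Ioc 0 w) : sin t ≠ 0 :=
  (sin_pos_of_pos_of_lt_pi ht.1 (by linarith [ht.2, pi_pos])).ne'

lemma tau_integrable {w a : ℝ} (hw : w ∈ Ioo 0 (π / 2)) (ha : 0 < a) (k : ℤ) {f g : ℝ → ℂ}
    (hf : ContDiffOn ℝ (⊤ : ℕ∞) f (Ioc 0 w)) (hg : ContDiffOn ℝ (⊤ : ℕ∞) g (Ioc 0 w)) :
    IntegrableOn (fun t => ‖tauFst k f g t - (1 / 2) * f t‖ ^ 2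
      + ‖tauSnd k f g t - (1 / 2) * g t‖ ^ 2) (Ioo a w) := by
  have hsub : Icc a w ⊆ Ioc 0 w := fun x hx => ⟨ha.trans_le hx.1, hx.2⟩
  have hcot : ContinuousOn (fun t => ((cos t / sin t : ℝ) : ℂ)) (Icc a w) := by
    refine Complex.continuous_ofReal.comp_continuousOn ?_
    exact continuous_cos.continuousOn.div continuous_sin.continuousOn
      fun t ht => sin_ne_of_mem hw.2 (hsub ht)
  have f0 := hf.continuousOn.mono hsub
  have g0 := hg.continuousOn.mono hsub
  have f1 := (derivWithin_cont hw.1 hf).mono hsub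
  have g1 := (derivWithin_cont hw.1 hg).mono hsub
  have hI : IntegrableOn (fun t =>
      ‖(((k : ℂ) + 1) * f t - derivWithin g (Ioc 0 w) t
        - ((k : ℂ) + 1 / 2) * ((cos t / sin t : ℝ) : ℂ) * g t) - (1 / 2) * f t‖ ^ 2
      + ‖(derivWithin f (Ioc 0 w) t - ((k : ℂ) + 1 / 2) * ((cos t / sin t : ℝ) : ℂ) * f t
        - (k : ℂ) * g t) - (1 / 2) * g t‖ ^ 2) (Icc a w) := by
    refine ContinuousOn.integrableOn_compact isCompact_Icc ?_
    fun_prop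
  refine (hI.mono_set Ioo_subset_Icc_self).congr_fun ?_ measurableSet_Ioo
  intro t ht
  have ht' : t ∈ Ioo 0 w := ⟨ha.trans ht.1, ht.2⟩
  simp only [tauFst, tauSnd, derivWithin_eq ht']

lemma norm_integrable {w a : ℝ} (ha : 0 < a) {f : ℝ → ℂ}
    (hf : ContDiffOn ℝ (⊤ : ℕ∞) f (Ioc 0 w)) :
    IntegrableOn (fun t => ‖f t‖ ^ 2) (Ioo a w) := by
  have hsub : Icc a w ⊆ Ioc 0 w := fun x hx => ⟨ha.trans_le hx.1, hx.2⟩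
  have f0 := hf.continuousOn.mono hsub
  have hI : IntegrableOn (fun t => ‖f t‖ ^ 2) (Icc a w) :=
    ContinuousOn.integrableOn_compact isCompact_Icc (by fun_prop)
  exact hI.mono_set Ioo_subset_Icc_self

lemma shrink {w a d : ℝ} (ha : 0 < a) (had : a < d) {F : ℝ → ℝ} (hF : ∀ x < d, F x = 0) :
    ∫ t in Ioo 0 w, F t = ∫ t in Ioo a w, F t := by
  refine setIntegral_eq_of_subset_of_forall_sdiff_eq_zero measurableSet_Ioo
    (Ioo_subset_Ioo_left ha.le) ?_
  rintro x ⟨hx, hx'⟩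
  refine hF x (lt_of_le_of_lt ?_ had)
  by_contra hh
  exact hx' ⟨not_le.mp hh, hx.2⟩

lemma tau_zero {d t : ℝ} (k : ℤ) {f g : ℝ → ℂ} (hf : ∀ x < d, f x = 0) (hg : ∀ x < d, g x = 0)
    (ht : t < d) : tauFst k f g t = 0 ∧ tauSnd k f g t = 0 := by
  simp [tauFst, tauSnd, hf t ht, hg t ht, deriv_eq_zero_of_left hf ht,
    deriv_eq_zero_of_left hg ht]

lemma boundary_zero (m s co : ℝ) (hs : s ≠ 0) (h1 : s ^ 2 + co ^ 2 = 1) (z₁ z₂ z₃ z₄ : ℂ)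
    (e1 : z₁ = Complex.I * (s : ℂ) * z₃ - Complex.I * (co : ℂ) * z₄)
    (e2 : z₂ = -Complex.I * (co : ℂ) * z₃ - Complex.I * (s : ℂ) * z₄) :
    bForm m 0 (co / s) z₁.re z₂.re + bForm m 0 (co / s) z₁.im z₂.im
      + (bForm m 0 (co / s) z₃.re z₄.re + bForm m 0 (co / s) z₃.im z₄.im) = 0 := by
  have a1 : z₁.re = -(s * z₃.im) + co * z₄.im := by rw [e1]; simp
  have b1 : z₁.im = s * z₃.re - co * z₄.re := by rw [e1]; simp
  have a2 : z₂.re = co * z₃.im + s * z₄.im := by rw [e2]; simp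
  have b2 : z₂.im = -(co * z₃.re) - s * z₄.re := by rw [e2]; simp
  have key : ∀ x y : ℝ, bForm m 0 (co / s) (s * x - co * y) (-(co * x) - s * y)
      = - bForm m 0 (co / s) x y := by
    intro x y
    have : bForm m 0 (co / s) (s * x - co * y) (-(co * x) - s * y)
      = - (s ^ 2 + co ^ 2) * bForm m 0 (co / s) x y := by
      unfold bForm; field_simp; ring
    rw [this, h1]; ring
  have neg : ∀ x y : ℝ, bForm m 0 (co / s) (-x) (-y) = bForm m 0 (co / s) x y := by
    intro x y; unfold bForm; ring
  rw [b1, b2, key, a1, a2, show -(s * z₃.im) + co * z₄.im = -(s * z₃.im - co * z₄.im) by ring,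
    show co * z₃.im + s * z₄.im = -(-(co * z₃.im) - s * z₄.im) by ring, neg, key]
  ring

/-- Lower bound for the shifted fiber operator (Proposition 4.3): for `ω ∈ (0, π/2)`,
`k ∈ ℤ` and every `ψ` in the core `M`, `‖(T_k − 1/2)ψ‖_{L²} ≥ (π/(4ω)) ‖ψ‖_{L²}`. -/
theorem shifted_fiber_lower_bound (ω : ℝ) (hω : ω ∈ Ioo 0 (π / 2)) (k : ℤ)
    (ψ₁ ψ₂ ψ₃ ψ₄ : ℝ → ℂ) (hψ : InCore ω ψ₁ ψ₂ ψ₃ ψ₄) :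
    Real.sqrt (∫ θ in Ioo 0 ω,
        (‖tauFst k ψ₁ ψ₂ θ - (1 / 2) * ψ₁ θ‖ ^ 2
          + ‖tauSnd k ψ₁ ψ₂ θ - (1 / 2) * ψ₂ θ‖ ^ 2
          + ‖tauFst k ψ₃ ψ₄ θ - (1 / 2) * ψ₃ θ‖ ^ 2
          + ‖tauSnd k ψ₃ ψ₄ θ - (1 / 2) * ψ₄ θ‖ ^ 2)) ≥
      (π / (4 * ω)) * Real.sqrt (∫ θ in Ioo 0 ω,
        (‖ψ₁ θ‖ ^ 2 + ‖ψ₂ θ‖ ^ 2 + ‖ψ₃ θ‖ ^ 2 + ‖ψ₄ θ‖ ^ 2)) := by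
  obtain ⟨c1, c2, c3, c4, K1, S1, K2, S2, K3, S3, K4, S4, B1, B2⟩ := hψ
  obtain ⟨d1, p1, z1⟩ := exists_delta K1 S1
  obtain ⟨d2, p2, z2⟩ := exists_delta K2 S2
  obtain ⟨d3, p3, z3⟩ := exists_delta K3 S3
  obtain ⟨d4, p4, z4⟩ := exists_delta K4 S4
  obtain ⟨d, hd, hdω, l1, l2, l3, l4⟩ :
      ∃ d > 0, d ≤ ω ∧ d ≤ d1 ∧ d ≤ d2 ∧ d ≤ d3 ∧ d ≤ d4 := by
    refine ⟨min ω (min (min d1 d2) (min d3 d4)), ?_, ?_⟩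
    · simp only [gt_iff_lt, lt_min_iff]; exact ⟨hω.1, ⟨p1, p2⟩, p3, p4⟩
    · simp
  replace z1 : ∀ x < d, ψ₁ x = 0 := fun x hx => z1 x (hx.trans_le l1)
  replace z2 : ∀ x < d, ψ₂ x = 0 := fun x hx => z2 x (hx.trans_le l2)
  replace z3 : ∀ x < d, ψ₃ x = 0 := fun x hx => z3 x (hx.trans_le l3)
  replace z4 : ∀ x < d, ψ₄ x = 0 := fun x hx => z4 x (hx.trans_le l4)
  obtain ⟨a, ha, had⟩ := exists_between hd
  have haω : a < ω := had.trans_le hdω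
  have hω0 : 0 < ω := hω.1
  set c : ℝ := π / (2 * ω) with hc
  have hc1 : 1 ≤ c := by
    rw [hc, le_div_iff₀ (by positivity)]; linarith [hω.2]
  have hcω : c * ω = π / 2 := by rw [hc]; field_simp
  have hlam : (π / (4 * ω)) ^ 2 = c ^ 2 / 4 := by rw [hc]; field_simp; norm_num
  rw [shrink (F := fun θ => ‖tauFst k ψ₁ ψ₂ θ - (1 / 2) * ψ₁ θ‖ ^ 2
          + ‖tauSnd k ψ₁ ψ₂ θ - (1 / 2) * ψ₂ θ‖ ^ 2
          + ‖tauFst k ψ₃ ψ₄ θ - (1 / 2) * ψ₃ θ‖ ^ 2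
          + ‖tauSnd k ψ₃ ψ₄ θ - (1 / 2) * ψ₄ θ‖ ^ 2) ha had (by
      intro x hx
      simp [tau_zero k z1 z2 hx, tau_zero k z3 z4 hx, z1 x hx, z2 x hx, z3 x hx, z4 x hx]),
    shrink (F := fun θ => ‖ψ₁ θ‖ ^ 2 + ‖ψ₂ θ‖ ^ 2 + ‖ψ₃ θ‖ ^ 2 + ‖ψ₄ θ‖ ^ 2) ha had (by
      intro x hx
      simp [z1 x hx, z2 x hx, z3 x hx, z4 x hx])]
  have I1 : IntegrableOn (fun θ => ‖tauFst k ψ₁ ψ₂ θ - (1 / 2) * ψ₁ θ‖ ^ 2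
          + ‖tauSnd k ψ₁ ψ₂ θ - (1 / 2) * ψ₂ θ‖ ^ 2
          + ‖tauFst k ψ₃ ψ₄ θ - (1 / 2) * ψ₃ θ‖ ^ 2
          + ‖tauSnd k ψ₃ ψ₄ θ - (1 / 2) * ψ₄ θ‖ ^ 2) (Ioo a ω) := by
    have := (tau_integrable hω ha k c1 c2).add (tau_integrable hω ha k c3 c4)
    refine this.congr_fun ?_ measurableSet_Ioo
    intro t _
    simp only [Pi.add_apply]; ring
  have I2 : IntegrableOn (fun θ => ‖ψ₁ θ‖ ^ 2 + ‖ψ₂ θ‖ ^ 2 + ‖ψ₃ θ‖ ^ 2 + ‖ψ₄ θ‖ ^ 2)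
      (Ioo a ω) :=
    (((norm_integrable ha c1).add (norm_integrable ha c2)).add (norm_integrable ha c3)).add
      (norm_integrable ha c4)
  apply Real.le_sqrt_of_sq_le
  rw [mul_pow, Real.sq_sqrt (integral_nonneg fun t => by positivity), hlam]
  rw [← sub_nonneg, ← integral_const_mul, ← integral_sub I1 (I2.const_mul _)]
  -- the total derivative
  let ct : ℝ → ℝ := fun t => cos t / sin t
  let q : ℝ → ℝ := fun t => c / 2 * (cos (c * t) / sin (c * t))
  let m : ℝ := (k : ℝ) + 1 / 2
  let G : ℝ → ℝ := fun t =>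
    bForm m (q t) (ct t) (ψ₁ t).re (ψ₂ t).re + bForm m (q t) (ct t) (ψ₁ t).im (ψ₂ t).im
      + (bForm m (q t) (ct t) (ψ₃ t).re (ψ₄ t).re + bForm m (q t) (ct t) (ψ₃ t).im (ψ₄ t).im)
  have hsub : Icc a ω ⊆ Ioc 0 ω := fun x hx => ⟨ha.trans_le hx.1, hx.2⟩
  have hsinc : ∀ t ∈ Ioc 0 ω, sin (c * t) ≠ 0 := fun t ht => by
    have : c * t ≤ π / 2 := by rw [← hcω]; exact mul_le_mul_of_nonneg_left ht.2 (by linarith)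
    exact (sin_pos_of_pos_of_lt_pi (mul_pos (by linarith) ht.1) (by linarith [pi_pos])).ne'
  have Ga : G a = 0 := by
    simp [G, bForm, z1 a had, z2 a had, z3 a had, z4 a had]
  have Gω : G ω = 0 := by
    have hq : q ω = 0 := by simp [q, hcω]
    simp only [G, hq]
    exact boundary_zero m (sin ω) (cos ω) (sin_ne_of_mem hω.2 ⟨hω0, le_rfl⟩)
      (sin_sq_add_cos_sq ω) _ _ _ _ B1 B2
  have hctc : ContinuousOn ct (Icc a ω) :=
    continuous_cos.continuousOn.div continuous_sin.continuousOn
      fun t ht => sin_ne_of_mem hω.2 (hsub ht)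
  have hqc : ContinuousOn q (Icc a ω) := by
    refine continuousOn_const.mul (ContinuousOn.div ?_ ?_ fun t ht => hsinc t (hsub ht))
    · fun_prop
    · fun_prop
  have re_c : ∀ {f : ℝ → ℂ}, ContDiffOn ℝ (⊤ : ℕ∞) f (Ioc 0 ω) →
      ContinuousOn (fun t => (f t).re) (Icc a ω) := fun hf =>
    Complex.continuous_re.comp_continuousOn (hf.continuousOn.mono hsub)
  have im_c : ∀ {f : ℝ → ℂ}, ContDiffOn ℝ (⊤ : ℕ∞) f (Ioc 0 ω) →
      ContinuousOn (fun t => (f t).im) (Icc a ω) := fun hf =>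
    Complex.continuous_im.comp_continuousOn (hf.continuousOn.mono hsub)
  have hG : ContinuousOn G (Icc a ω) :=
    ((bForm_cont m hqc hctc (re_c c1) (re_c c2)).add
      (bForm_cont m hqc hctc (im_c c1) (im_c c2))).add
    ((bForm_cont m hqc hctc (re_c c3) (re_c c4)).add
      (bForm_cont m hqc hctc (im_c c3) (im_c c4)))
  let q' : ℝ → ℝ := fun t => c / 2 * (-(1 + (cos (c * t) / sin (c * t)) ^ 2) * c)
  let D : (ℝ → ℂ) → (ℝ → ℂ) → ℝ → ℝ := fun f g t =>
    bFormD m (q t) (ct t) (q' t) (-(1 + (ct t) ^ 2))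
        (f t).re (g t).re (deriv f t).re (deriv g t).re
      + bFormD m (q t) (ct t) (q' t) (-(1 + (ct t) ^ 2))
        (f t).im (g t).im (deriv f t).im (deriv g t).im
  have hGd : ∀ t ∈ Ioo a ω, HasDerivAt G (D ψ₁ ψ₂ t + D ψ₃ ψ₄ t) t := by
    intro t ht
    have ht' : t ∈ Ioo 0 ω := ⟨ha.trans ht.1, ht.2⟩
    have hct : HasDerivAt ct (-(1 + (ct t) ^ 2)) t :=
      cot_hasDerivAt (sin_ne_of_mem hω.2 ⟨ht'.1, ht'.2.le⟩)
    have hq : HasDerivAt q (q' t) t := by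
      have h0 : HasDerivAt (fun s => c * s) c t := by
        simpa using (hasDerivAt_id t).const_mul c
      exact ((cot_hasDerivAt (hsinc t ⟨ht'.1, ht'.2.le⟩)).comp t h0).const_mul (c / 2)
    have re_d : ∀ {f : ℝ → ℂ}, ContDiffOn ℝ (⊤ : ℕ∞) f (Ioc 0 ω) →
        HasDerivAt (fun t => (f t).re) (deriv f t).re t := fun hf =>
      Complex.reCLM.hasFDerivAt.comp_hasDerivAt t (hasDerivAt_of_core hf ht')
    have im_d : ∀ {f : ℝ → ℂ}, ContDiffOn ℝ (⊤ : ℕ∞) f (Ioc 0 ω) →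
        HasDerivAt (fun t => (f t).im) (deriv f t).im t := fun hf =>
      Complex.imCLM.hasFDerivAt.comp_hasDerivAt t (hasDerivAt_of_core hf ht')
    exact ((bForm_hasDerivAt m hq hct (re_d c1) (re_d c2)).add
      (bForm_hasDerivAt m hq hct (im_d c1) (im_d c2))).add
      ((bForm_hasDerivAt m hq hct (re_d c3) (re_d c4)).add
      (bForm_hasDerivAt m hq hct (im_d c3) (im_d c4)))
  have fin := intervalIntegral.sub_le_integral_of_hasDeriv_right_of_le haω.le hG
    (fun t ht => (hGd t ht).hasDerivWithinAt)
    ((integrableOn_Icc_iff_integrableOn_Ioo (μ := volume)).mpr (I1.sub (I2.const_mul (c ^ 2 / 4))))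
    (by
      intro t ht
      have ht0 : 0 < t := ha.trans ht.1
      have hctle : c * t ≤ π / 2 := by
        rw [← hcω]; exact mul_le_mul_of_nonneg_left ht.2.le (by linarith)
      have hw := weight_ineq hc1 ht0 hctle
      have h1 := complex_pair k ψ₁ ψ₂ t (q t) (q' t) (c ^ 2 / 4) hw
      have h2 := complex_pair k ψ₃ ψ₄ t (q t) (q' t) (c ^ 2 / 4) hw
      simp only [D, m, ct, Pi.sub_apply]
      linarith)
  rw [Ga, Gω, intervalIntegral.integral_of_le haω.le, integral_Ioc_eq_integral_Ioo] at fin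
  simpa using fin

end
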